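/- Let L > 0 and q > 0 satisfy π/(2·arctan(1/L)) + 2/q > 2, set β = π/(2·arctan(1/L)), and let Ω = {(x, y) ∈ ℝ² : y > L|x|}. Then for every δ > 0 there exist functions u, v : ℝ² → ℝ, continuous on the closure of Ω, smooth in Ω, positive in Ω, vanishing on ∂Ω, with u(0,1) = v(0,1) = 1, such that the Laplacian of u vanishes identically in Ω (u is harmonic in Ω), (∫_Ω |Δv|^q)^{1/q} < δ, and sup_{Ω} u/v = ∞, i.e. for every M > 0 there is a point z ∈ Ω ∩ B_{1/2} with u(z) > M·v(z). -/

import Mathlib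

open Metric MeasureTheory Set Filter Matrix

noncomputable section

abbrev E2 := EuclideanSpace ℝ (Fin 2)

/-- Second-order partial derivative entries of the Hessian. -/
def hess2 (u : E2 → ℝ) (z : E2) (i j : Fin 2) : ℝ :=
  fderiv ℝ (fun y => fderiv ℝ u y (EuclideanSpace.single j 1)) z (EuclideanSpace.single i 1)

/-- The Laplacian `Δu = ∂²u/∂x² + ∂²u/∂y²`. -/
def lap2 (u : E2 → ℝ) (z : E2) : ℝ := hess2 u z 0 0 + hess2 u z 1 1

/-- The cone `Ω = {(x,y) : y > L|x|}`. -/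
def coneL (L : ℝ) : Set E2 := {z | L * |z 0| < z 1}

/-- The point `(0,1)`. -/
def p01 : E2 := EuclideanSpace.single 1 1

/-- `f` is differentiable at `z` with `j`-th partial derivative `d`. -/
def HasPartialAt (f : E2 → ℝ) (j : Fin 2) (d : ℝ) (z : E2) : Prop :=
  ∃ f' : E2 →L[ℝ] ℝ, HasFDerivAt f f' z ∧ f' (EuclideanSpace.single j 1) = d

namespace HasPartialAt

variable {f g : E2 → ℝ} {j : Fin 2} {a b : ℝ} {z : E2}

lemma fderiv_eq (h : HasPartialAt f j a z) :
    fderiv ℝ f z (EuclideanSpace.single j 1) = a := by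
  obtain ⟨f', hf, h⟩ := h
  rw [hf.fderiv, h]

lemma add (hf : HasPartialAt f j a z) (hg : HasPartialAt g j b z) :
    HasPartialAt (fun y => f y + g y) j (a + b) z := by
  obtain ⟨f', hf, rfl⟩ := hf
  obtain ⟨g', hg, rfl⟩ := hg
  exact ⟨f' + g', hf.add hg, rfl⟩

lemma mul (hf : HasPartialAt f j a z) (hg : HasPartialAt g j b z) :
    HasPartialAt (fun y => f y * g y) j (a * g z + f z * b) z := by
  obtain ⟨f', hf, rfl⟩ := hf
  obtain ⟨g', hg, rfl⟩ := hg
  refine ⟨_, hf.mul hg, ?_⟩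
  simp
  ring

lemma const (c : ℝ) (j : Fin 2) (z : E2) : HasPartialAt (fun _ => c) j 0 z :=
  ⟨0, hasFDerivAt_const c z, rfl⟩

lemma const_mul (c : ℝ) (hf : HasPartialAt f j a z) :
    HasPartialAt (fun y => c * f y) j (c * a) z := by
  simpa using (const c j z).mul hf

lemma coord (i j : Fin 2) (z : E2) :
    HasPartialAt (fun y => y i) j (if i = j then 1 else 0) z :=
  ⟨EuclideanSpace.proj i, (EuclideanSpace.proj (𝕜 := ℝ) i).hasFDerivAt, by simp⟩

lemma exp (hf : HasPartialAt f j a z) :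
    HasPartialAt (fun y => Real.exp (f y)) j (Real.exp (f z) * a) z := by
  obtain ⟨f', hf, rfl⟩ := hf
  exact ⟨_, hf.exp, rfl⟩

end HasPartialAt

lemma lap2_eq_of_hasPartialAt {S : Set E2} (hS : IsOpen S) {f : E2 → ℝ} {F : Fin 2 → E2 → ℝ}
    (hf : ∀ y ∈ S, ∀ j, HasPartialAt f j (F j y) y) {z : E2} (hz : z ∈ S) {d : Fin 2 → ℝ}
    (hF : ∀ j, HasPartialAt (F j) j (d j) z) : lap2 f z = d 0 + d 1 := by
  have key : ∀ j, hess2 f z j j = d j := by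
    intro j
    have h : (fun y => fderiv ℝ f y (EuclideanSpace.single j 1)) =ᶠ[nhds z] F j := by
      filter_upwards [hS.mem_nhds hz] with y hy using (hf y hy j).fderiv_eq
    rw [hess2, h.fderiv_eq, (hF j).fderiv_eq]
  rw [lap2, key, key]

/-- The plane identified with `ℂ`, with the axis of the cone sent to the positive real axis. -/
def axisComplex : E2 →L[ℝ] ℂ :=
  (EuclideanSpace.proj (𝕜 := ℝ) (1 : Fin 2)).smulRight (1 : ℂ) +
    (EuclideanSpace.proj (𝕜 := ℝ) (0 : Fin 2)).smulRight Complex.I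

@[simp] lemma axisComplex_re (z : E2) : (axisComplex z).re = z 1 := by simp [axisComplex]

@[simp] lemma axisComplex_im (z : E2) : (axisComplex z).im = z 0 := by simp [axisComplex]

lemma norm_axisComplex (z : E2) : ‖axisComplex z‖ = ‖z‖ := by
  rw [Complex.norm_eq_sqrt_sq_add_sq, EuclideanSpace.norm_eq, Fin.sum_univ_two]
  simp [add_comm]

lemma norm_sq_eq_coord (z : E2) : ‖z‖ ^ 2 = z 0 * z 0 + z 1 * z 1 := by
  rw [EuclideanSpace.real_norm_sq_eq, Fin.sum_univ_two]
  ring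

lemma hasPartialAt_re_cpow (a c : ℂ) (j : Fin 2) {z : E2} (hz : 0 < z 1) :
    HasPartialAt (fun y => (a * axisComplex y ^ c).re) j
      (a * c * axisComplex (EuclideanSpace.single j 1) * axisComplex z ^ (c - 1)).re z := by
  have hs : axisComplex z ∈ Complex.slitPlane := Or.inl (by simpa using hz)
  have h1 := (((hasDerivAt_id (axisComplex z)).cpow_const (c := c) hs).const_mul
    a).hasFDerivAt.restrictScalars ℝ
  have h2 := Complex.reCLM.hasFDerivAt.comp z (h1.comp z axisComplex.hasFDerivAt)
  refine ⟨_, h2, ?_⟩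
  simp only [ContinuousLinearMap.comp_apply, Complex.reCLM_apply,
    ContinuousLinearMap.coe_restrictScalars', ContinuousLinearMap.toSpanSingleton_apply, id]
  congr 1
  simp only [smul_eq_mul]
  ring

/-- The homogeneous harmonic function `r ^ β * cos (β * φ)`, with `φ` the angle to the axis. -/
def coneHarmonic (β : ℝ) (z : E2) : ℝ := (axisComplex z ^ (β : ℂ)).re

/-- The partial derivatives of `coneHarmonic β`. -/
def coneHarmonicPartial (β : ℝ) (j : Fin 2) (z : E2) : ℝ :=
  (β * axisComplex (EuclideanSpace.single j 1) * axisComplex z ^ ((β : ℂ) - 1)).re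

lemma coneHarmonic_eq (β : ℝ) (z : E2) :
    coneHarmonic β z = ‖z‖ ^ β * Real.cos (Complex.arg (axisComplex z) * β) := by
  rw [coneHarmonic, Complex.cpow_ofReal_re, norm_axisComplex]

lemma abs_coneHarmonic_le (β : ℝ) (z : E2) : |coneHarmonic β z| ≤ ‖z‖ ^ β := by
  rw [coneHarmonic_eq, abs_mul, abs_of_nonneg (Real.rpow_nonneg (norm_nonneg z) β)]
  exact mul_le_of_le_one_right (Real.rpow_nonneg (norm_nonneg z) β) (Real.abs_cos_le_one _)

lemma coneHarmonic_smul (β : ℝ) {s : ℝ} (hs : 0 < s) (z : E2) :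
    coneHarmonic β (s • z) = s ^ β * coneHarmonic β z := by
  rw [coneHarmonic_eq, coneHarmonic_eq, map_smul, Complex.real_smul, Complex.arg_real_mul _ hs,
    norm_smul, Real.norm_of_nonneg hs.le, Real.mul_rpow hs.le (norm_nonneg z), mul_assoc]

lemma hasPartialAt_coneHarmonic (β : ℝ) (j : Fin 2) {z : E2} (hz : 0 < z 1) :
    HasPartialAt (coneHarmonic β) j (coneHarmonicPartial β j z) z := by
  have h := hasPartialAt_re_cpow 1 β j hz
  simp only [one_mul] at h
  exact h

lemma axisComplex_single_zero : axisComplex (EuclideanSpace.single 0 1) = Complex.I := by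
  apply Complex.ext <;> simp

lemma axisComplex_single_one : axisComplex (EuclideanSpace.single 1 1) = 1 := by
  apply Complex.ext <;> simp

lemma coneHarmonic_euler (β : ℝ) {z : E2} (hz : 0 < z 1) :
    coneHarmonicPartial β 0 z * z 0 + coneHarmonicPartial β 1 z * z 1 =
      β * coneHarmonic β z := by
  have h0 : axisComplex z ≠ 0 := fun h => by
    have := congrArg Complex.re h
    simp at this
    exact hz.ne' this
  have h : axisComplex z ^ (β : ℂ) = axisComplex z ^ ((β : ℂ) - 1) * axisComplex z := by
    rw [Complex.cpow_sub _ _ h0, Complex.cpow_one, div_mul_cancel₀ _ h0]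
  rw [coneHarmonicPartial, coneHarmonicPartial, coneHarmonic, h, axisComplex_single_zero,
    axisComplex_single_one]
  simp
  ring

lemma exists_hasPartialAt_coneHarmonicPartial (β : ℝ) {z : E2} (hz : 0 < z 1) :
    ∃ w : ℝ, HasPartialAt (coneHarmonicPartial β 0) 0 (-w) z ∧
      HasPartialAt (coneHarmonicPartial β 1) 1 w z := by
  have h (j : Fin 2) := hasPartialAt_re_cpow (β * axisComplex (EuclideanSpace.single j 1))
    (β - 1) j hz
  refine ⟨(β * (β - 1) * axisComplex z ^ ((β : ℂ) - 1 - 1)).re, ?_, ?_⟩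
  · refine (congrArg (HasPartialAt _ 0 · z) ?_).mpr (h 0)
    rw [axisComplex_single_zero, ← Complex.neg_re]
    congr 1
    linear_combination (-β * (β - 1) * axisComplex z ^ ((β : ℂ) - 1 - 1)) * Complex.I_mul_I
  · refine (congrArg (HasPartialAt _ 1 · z) ?_).mpr (h 1)
    rw [axisComplex_single_one]
    simp only [mul_one]

section Cone

variable {L : ℝ}

lemma isOpen_coneL : IsOpen (coneL L) := by
  apply isOpen_lt <;> fun_prop

lemma pos_of_mem_coneL (hL : 0 < L) {z : E2} (hz : z ∈ coneL L) : 0 < z 1 :=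
  lt_of_le_of_lt (by positivity) hz

lemma closure_coneL_subset : closure (coneL L) ⊆ {z | L * |z 0| ≤ z 1} :=
  closure_minimal (fun z (h : L * |z 0| < z 1) => h.le) (isClosed_le (by fun_prop) (by fun_prop))

lemma frontier_coneL_subset : frontier (coneL L) ⊆ {z | L * |z 0| = z 1} := by
  intro z hz
  rw [frontier, isOpen_coneL.interior_eq] at hz
  exact le_antisymm (closure_coneL_subset hz.1) (not_lt.1 hz.2)

lemma smul_mem_coneL_iff {s : ℝ} (hs : 0 < s) {z : E2} : s • z ∈ coneL L ↔ z ∈ coneL L := by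
  simp only [coneL, mem_ofPred_eq, PiLp.smul_apply, smul_eq_mul, abs_mul, abs_of_pos hs]
  rw [mul_left_comm, mul_lt_mul_iff_right₀ hs]

lemma arg_axisComplex {z : E2} (hz : 0 < z 1) :
    Complex.arg (axisComplex z) = Real.arctan (z 0 / z 1) := by
  have h := Complex.abs_arg_lt_pi_div_two_iff.2
    (Or.inl (by simpa using hz : 0 < (axisComplex z).re))
  rw [← Real.arctan_tan (abs_lt.1 h).1 (abs_lt.1 h).2, Complex.tan_arg, axisComplex_re,
    axisComplex_im]

lemma abs_arctan (x : ℝ) : |Real.arctan x| = Real.arctan |x| := by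
  rcases le_total 0 x with h | h
  · rw [abs_of_nonneg h, abs_of_nonneg (Real.arctan_nonneg.2 h)]
  · rw [abs_of_nonpos h, Real.arctan_neg, abs_of_nonpos
      (Real.arctan_zero ▸ Real.arctan_strictMono.monotone h)]

lemma continuousOn_coneHarmonic {β : ℝ} (hL : 0 < L) (hβ : 0 < β) :
    ContinuousOn (coneHarmonic β) (closure (coneL L)) := by
  intro z hz
  have h1 : 0 ≤ z 1 := le_trans (by positivity) (closure_coneL_subset hz)
  have h := Complex.continuousAt_cpow_const_of_re_pos (z := axisComplex z) (w := β)
    (Or.inl (by simpa using h1)) (by simpa using hβ)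
  exact (Complex.continuous_re.continuousAt.comp
    (h.comp axisComplex.continuous.continuousAt)).continuousWithinAt

lemma contDiffOn_coneHarmonic (β : ℝ) (hL : 0 < L) :
    ContDiffOn ℝ (⊤ : ℕ∞) (coneHarmonic β) (coneL L) := by
  intro z hz
  have h : AnalyticAt ℂ (fun w : ℂ => w ^ (β : ℂ)) (axisComplex z) :=
    analyticAt_id.cpow analyticAt_const (Or.inl (by simpa using pos_of_mem_coneL hL hz))
  have h1 : ContDiffAt ℝ (⊤ : ℕ∞) (fun w : ℂ => w ^ (β : ℂ)) (axisComplex z) :=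
    h.contDiffAt.restrict_scalars ℝ
  exact (Complex.reCLM.contDiff.contDiffAt.comp z
    (h1.comp z axisComplex.contDiff.contDiffAt)).contDiffWithinAt

lemma arctan_mul_opening (hL : 0 < L) :
    Real.arctan (1 / L) * (Real.pi / (2 * Real.arctan (1 / L))) = Real.pi / 2 := by
  have : 0 < Real.arctan (1 / L) := Real.arctan_pos.2 (by positivity)
  field_simp

lemma opening_pos (hL : 0 < L) : 0 < Real.pi / (2 * Real.arctan (1 / L)) := by
  have : 0 < Real.arctan (1 / L) := Real.arctan_pos.2 (by positivity)
  positivity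

lemma coneHarmonic_pos (hL : 0 < L) {z : E2} (hz : z ∈ coneL L) :
    0 < coneHarmonic (Real.pi / (2 * Real.arctan (1 / L))) z := by
  have h1 := pos_of_mem_coneL hL hz
  have hz0 : 0 < ‖z‖ := norm_pos_iff.2 (fun h => by simp [h] at h1)
  rw [coneHarmonic_eq]
  refine mul_pos (Real.rpow_pos_of_pos hz0 _) (Real.cos_pos_of_mem_Ioo (abs_lt.1 ?_))
  rw [abs_mul, abs_of_pos (opening_pos hL), ← arctan_mul_opening hL]
  refine mul_lt_mul_of_pos_right ?_ (opening_pos hL)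
  rw [arg_axisComplex h1, abs_arctan, abs_div, abs_of_pos h1]
  refine Real.arctan_strictMono ?_
  rw [div_lt_div_iff₀ h1 hL]
  have : L * |z 0| < z 1 := hz
  linarith

lemma coneHarmonic_eq_zero (hL : 0 < L) {z : E2} (hz : z ∈ frontier (coneL L)) :
    coneHarmonic (Real.pi / (2 * Real.arctan (1 / L))) z = 0 := by
  have hz : L * |z 0| = z 1 := frontier_coneL_subset hz
  have h0 : 0 ≤ z 1 := hz ▸ by positivity
  rw [coneHarmonic_eq]
  rcases h0.eq_or_lt with h1 | h1
  · have h2 : z 0 = 0 := by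
      rw [← h1] at hz
      simpa [hL.ne'] using hz
    have : z = 0 := by
      ext i
      fin_cases i
      · simpa using h2
      · simpa using h1.symm
    rw [this, norm_zero, Real.zero_rpow (opening_pos hL).ne', zero_mul]
  · have : |z 0| / z 1 = 1 / L := by
      rw [div_eq_div_iff h1.ne' hL.ne']
      linarith
    rw [← Real.cos_abs, abs_mul, abs_of_pos (opening_pos hL), arg_axisComplex h1, abs_arctan,
      abs_div, abs_of_pos h1, this, arctan_mul_opening hL, Real.cos_pi_div_two, mul_zero]

lemma lap2_coneHarmonic (β : ℝ) (hL : 0 < L) {z : E2} (hz : z ∈ coneL L) :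
    lap2 (coneHarmonic β) z = 0 := by
  obtain ⟨w, h0, h1⟩ := exists_hasPartialAt_coneHarmonicPartial β (pos_of_mem_coneL hL hz)
  rw [lap2_eq_of_hasPartialAt (d := ![-w, w]) isOpen_coneL
    (fun y hy j => hasPartialAt_coneHarmonic β j (pos_of_mem_coneL hL hy)) hz]
  · simp
  · intro j
    fin_cases j
    · exact h0
    · exact h1

/-- The Laplacian of `coneHarmonic β * (1 - exp (-‖z‖ ^ 2))`, up to the factor `4`. -/
def dampedLaplacian (β : ℝ) (z : E2) : ℝ :=
  coneHarmonic β z * Real.exp (-‖z‖ ^ 2) * (β + 1 - ‖z‖ ^ 2)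

lemma lap2_damped (β K b : ℝ) (hL : 0 < L) {z : E2} (hz : z ∈ coneL L) :
    lap2 (fun y => coneHarmonic β y * (K + -K * Real.exp (-b * (y 0 * y 0 + y 1 * y 1)))) z =
      4 * K * b * (coneHarmonic β z * Real.exp (-(b * ‖z‖ ^ 2)) * (β + 1 - b * ‖z‖ ^ 2)) := by
  have hE (j : Fin 2) (y : E2) :
      HasPartialAt (fun y => Real.exp (-b * (y 0 * y 0 + y 1 * y 1))) j
        (Real.exp (-b * (y 0 * y 0 + y 1 * y 1)) * (-2 * b * y j)) y := by
    convert! (((HasPartialAt.coord 0 j y).mul (HasPartialAt.coord 0 j y)).add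
      ((HasPartialAt.coord 1 j y).mul (HasPartialAt.coord 1 j y))).const_mul (-b) |>.exp using 2
    fin_cases j <;> simp <;> ring
  have hg (j : Fin 2) (y : E2) := (HasPartialAt.const K j y).add ((hE j y).const_mul (-K))
  obtain ⟨w, h0, h1⟩ := exists_hasPartialAt_coneHarmonicPartial β (pos_of_mem_coneL hL hz)
  have hW : ∀ j, HasPartialAt (coneHarmonicPartial β j) j (![-w, w] j) z := by
    intro j
    fin_cases j
    · exact h0
    · exact h1
  have hx (j : Fin 2) := (HasPartialAt.coord j j z).const_mul (-2 * b)
  rw [lap2_eq_of_hasPartialAt isOpen_coneL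
    (fun y hy j => (hasPartialAt_coneHarmonic β j (pos_of_mem_coneL hL hy)).mul (hg j y)) hz
    (fun j => ((hW j).mul (hg j z)).add
      ((hasPartialAt_coneHarmonic β j (pos_of_mem_coneL hL hz)).mul
        ((HasPartialAt.const 0 j z).add (((hE j z).mul (hx j)).const_mul (-K)))))]
  have he := coneHarmonic_euler β (pos_of_mem_coneL hL hz)
  rw [norm_sq_eq_coord, ← neg_mul]
  simp only [Matrix.cons_val_zero, Matrix.cons_val_one, if_true]
  linear_combination (4 * K * b * Real.exp (-b * (z 0 * z 0 + z 1 * z 1))) * he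

lemma lap2_damped_eq_smul (β K : ℝ) {s : ℝ} (hs : 0 < s) (hL : 0 < L) {z : E2}
    (hz : z ∈ coneL L) :
    lap2 (fun y => coneHarmonic β y *
      (K + -K * Real.exp (-s ^ 2 * (y 0 * y 0 + y 1 * y 1)))) z =
      4 * K * s ^ (2 - β) * dampedLaplacian β (s • z) := by
  have h : s ^ (2 - β) * s ^ β = s ^ 2 := by
    rw [← Real.rpow_add hs, sub_add_cancel, Real.rpow_two]
  rw [lap2_damped β K (s ^ 2) hL hz, dampedLaplacian, coneHarmonic_smul β hs, norm_smul,
    Real.norm_of_nonneg hs.le, mul_pow, ← h]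
  ring

lemma exists_abs_dampedLaplacian_le {β : ℝ} (hβ : 0 < β) :
    ∃ C : ℝ, 0 < C ∧ ∀ z, |dampedLaplacian β z| ≤ C * Real.exp (-(1 / 2) * ‖z‖ ^ 2) := by
  set n := ⌈β⌉₊
  refine ⟨(β + 1) * (2 ^ (n + 1) * (n + 1).factorial * Real.exp (1 / 2)), by positivity,
    fun z => ?_⟩
  have hz := norm_nonneg z
  have h1 : ‖z‖ ^ β ≤ (1 + ‖z‖ ^ 2) ^ n := by
    calc ‖z‖ ^ β ≤ (1 + ‖z‖ ^ 2) ^ β :=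
          Real.rpow_le_rpow hz (by nlinarith [sq_nonneg (‖z‖ - 1)]) hβ.le
      _ ≤ (1 + ‖z‖ ^ 2) ^ (n : ℝ) :=
          Real.rpow_le_rpow_of_exponent_le (by nlinarith) (Nat.le_ceil β)
      _ = _ := Real.rpow_natCast _ _
  have h2 : |β + 1 - ‖z‖ ^ 2| ≤ (β + 1) * (1 + ‖z‖ ^ 2) := by
    rw [abs_le]
    constructor <;> nlinarith [sq_nonneg ‖z‖, mul_nonneg hβ.le (sq_nonneg ‖z‖)]
  have h3 : (1 + ‖z‖ ^ 2) ^ (n + 1) ≤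
      2 ^ (n + 1) * (n + 1).factorial * Real.exp ((1 + ‖z‖ ^ 2) / 2) := by
    have := Real.pow_div_factorial_le_exp ((1 + ‖z‖ ^ 2) / 2) (by positivity) (n + 1)
    rw [div_pow, div_div, div_le_iff₀ (by positivity)] at this
    linarith
  have h4 : Real.exp ((1 + ‖z‖ ^ 2) / 2) * Real.exp (-‖z‖ ^ 2) =
      Real.exp (1 / 2) * Real.exp (-(1 / 2) * ‖z‖ ^ 2) := by
    rw [← Real.exp_add, ← Real.exp_add]
    ring_nf
  rw [dampedLaplacian, abs_mul, abs_mul, Real.abs_exp]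
  calc |coneHarmonic β z| * Real.exp (-‖z‖ ^ 2) * |β + 1 - ‖z‖ ^ 2|
      ≤ (1 + ‖z‖ ^ 2) ^ n * Real.exp (-‖z‖ ^ 2) * ((β + 1) * (1 + ‖z‖ ^ 2)) := by
        gcongr
        exact (abs_coneHarmonic_le β z).trans h1
    _ = (β + 1) * (1 + ‖z‖ ^ 2) ^ (n + 1) * Real.exp (-‖z‖ ^ 2) := by ring
    _ ≤ (β + 1) * (2 ^ (n + 1) * (n + 1).factorial * Real.exp ((1 + ‖z‖ ^ 2) / 2)) *
          Real.exp (-‖z‖ ^ 2) := by gcongr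
    _ = _ := by linear_combination ((β + 1) * (2 ^ (n + 1) * (n + 1).factorial)) * h4

lemma integrable_exp_neg_mul_norm_sq {c : ℝ} (hc : 0 < c) :
    Integrable (fun z : E2 => Real.exp (-c * ‖z‖ ^ 2)) := by
  have h := (GaussianFourier.integrable_cexp_neg_mul_sq_norm_add (V := E2) (b := c)
    (by simpa using hc) 0 0).norm
  refine h.congr (Eventually.of_forall fun z => ?_)
  simp [Complex.norm_exp, ← Complex.ofReal_pow]

lemma integrableOn_dampedLaplacian {β q : ℝ} (hβ : 0 < β) (hq : 0 < q) (hL : 0 < L) :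
    IntegrableOn (fun z => |dampedLaplacian β z| ^ q) (coneL L) := by
  obtain ⟨C, hC, hb⟩ := exists_abs_dampedLaplacian_le hβ
  have hc : ContinuousOn (dampedLaplacian β) (coneL L) := by
    refine ContinuousOn.mul (ContinuousOn.mul ?_ ?_) ?_
    · exact (continuousOn_coneHarmonic hL hβ).mono subset_closure
    · fun_prop
    · fun_prop
  refine Integrable.mono' (((integrable_exp_neg_mul_norm_sq
    (c := 1 / 2 * q) (by positivity)).const_mul (C ^ q)).integrableOn)
    ((hc.abs.rpow_const fun _ _ => Or.inr hq.le).aestronglyMeasurable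
      isOpen_coneL.measurableSet) (Eventually.of_forall fun z => ?_)
  rw [Real.norm_of_nonneg (Real.rpow_nonneg (abs_nonneg _) q)]
  refine (Real.rpow_le_rpow (abs_nonneg _) (hb z) hq.le).trans_eq ?_
  rw [Real.mul_rpow hC.le (Real.exp_pos _).le, ← Real.exp_mul]
  ring_nf

lemma integrableOn_coneL_comp_smul {f : E2 → ℝ} (hf : IntegrableOn f (coneL L)) {s : ℝ}
    (hs : 0 < s) : IntegrableOn (fun z => f (s • z)) (coneL L) := by
  rw [← integrable_indicator_iff isOpen_coneL.measurableSet] at hf ⊢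
  refine (hf.comp_smul hs.ne').congr (Eventually.of_forall fun z => ?_)
  by_cases hz : z ∈ coneL L
  · simp [hz, (smul_mem_coneL_iff hs).2 hz]
  · simp [hz, mt (smul_mem_coneL_iff hs).1 hz]

open scoped Pointwise in
lemma integral_coneL_comp_smul (f : E2 → ℝ) {s : ℝ} (hs : 0 < s) :
    ∫ z in coneL L, f (s • z) = (s ^ 2)⁻¹ * ∫ z in coneL L, f z := by
  have h : s • coneL L = coneL L := by
    ext z
    rw [Set.mem_smul_set_iff_inv_smul_mem₀ hs.ne', smul_mem_coneL_iff (inv_pos.2 hs)]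
  rw [Measure.setIntegral_comp_smul_of_pos volume f (coneL L) hs, h]
  simp

end Cone

theorem counterexample_Lq
    (L q : ℝ) (hL : 0 < L) (hq : 0 < q)
    (hcond : 2 < Real.pi / (2 * Real.arctan (1/L)) + 2/q) :
    ∀ δ : ℝ, 0 < δ → ∃ u v : E2 → ℝ,
      ContinuousOn u (closure (coneL L)) ∧ ContinuousOn v (closure (coneL L)) ∧
      ContDiffOn ℝ (⊤ : ℕ∞) u (coneL L) ∧ ContDiffOn ℝ (⊤ : ℕ∞) v (coneL L) ∧
      (∀ z ∈ coneL L, 0 < u z) ∧ (∀ z ∈ coneL L, 0 < v z) ∧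
      (∀ z ∈ frontier (coneL L), u z = 0) ∧ (∀ z ∈ frontier (coneL L), v z = 0) ∧
      u p01 = 1 ∧ v p01 = 1 ∧
      (∀ z ∈ coneL L, lap2 u z = 0) ∧
      IntegrableOn (fun z => |lap2 v z| ^ q) (coneL L) ∧
      (∫ z in coneL L, |lap2 v z| ^ q) ^ (1/q) < δ ∧
      (∀ M : ℝ, 0 < M → ∃ z ∈ coneL L ∩ ball (0 : E2) (1/2), M * v z < u z) := by
  intro δ hδ
  set β := Real.pi / (2 * Real.arctan (1 / L)) with hβ_def
  have hβ : 0 < β := opening_pos hL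
  set I := ∫ z in coneL L, |dampedLaplacian β z| ^ q
  have hI : 0 ≤ I := integral_nonneg fun z => Real.rpow_nonneg (abs_nonneg _) q
  obtain ⟨s, hs1, hsδ⟩ : ∃ s : ℝ, 1 ≤ s ∧ 8 * s ^ (-(β + 2 / q - 2)) * I ^ (1 / q) < δ := by
    have h : Tendsto (fun s : ℝ => 8 * s ^ (-(β + 2 / q - 2)) * I ^ (1 / q)) atTop (nhds 0) := by
      simpa using ((tendsto_rpow_neg_atTop (sub_pos.2 hcond)).const_mul 8).mul_const (I ^ (1 / q))
    exact ((eventually_ge_atTop 1).and (h.eventually_lt_const hδ)).exists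
  have hs : 0 < s := by linarith
  have hexp : Real.exp (-s ^ 2) ≤ 1 / 2 := by
    have h1 : 2 ≤ Real.exp (s ^ 2) := by nlinarith [Real.add_one_le_exp (s ^ 2)]
    rw [Real.exp_neg, ← one_div]
    exact one_div_le_one_div_of_le (by norm_num) h1
  set K := (1 - Real.exp (-s ^ 2))⁻¹ with hK_def
  have hK : 0 < K := inv_pos.2 (by linarith)
  have hK2 : K ≤ 2 := by
    rw [hK_def, inv_le_comm₀ (by linarith) (by norm_num)]
    linarith
  set v : E2 → ℝ := fun y => coneHarmonic β y *
    (K + -K * Real.exp (-s ^ 2 * (y 0 * y 0 + y 1 * y 1))) with hv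
  have hsq : ∀ z ∈ coneL L, |lap2 v z| ^ q =
      (4 * K * s ^ (2 - β)) ^ q * |dampedLaplacian β (s • z)| ^ q := by
    intro z hz
    rw [hv, lap2_damped_eq_smul β K hs hL hz, abs_mul, abs_of_nonneg (by positivity),
      Real.mul_rpow (by positivity) (abs_nonneg _)]
  have hone : coneHarmonic β p01 = 1 := by
    rw [coneHarmonic, p01, axisComplex_single_one, Complex.one_cpow, Complex.one_re]
  have hp : p01 ∈ coneL L := by simp [coneL, p01]
  have hmeas := (isOpen_coneL (L := L)).measurableSet
  refine ⟨coneHarmonic β, v, continuousOn_coneHarmonic hL hβ,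
    (continuousOn_coneHarmonic hL hβ).mul (by fun_prop), contDiffOn_coneHarmonic β hL,
    (contDiffOn_coneHarmonic β hL).mul (by fun_prop), fun z hz => coneHarmonic_pos hL hz,
    fun z hz => ?_, fun z hz => coneHarmonic_eq_zero hL hz, fun z hz => ?_, hone, ?_,
    fun z hz => lap2_coneHarmonic β hL hz, ?_, ?_, fun M hM => ?_⟩
  · refine mul_pos (coneHarmonic_pos hL hz) ?_
    have h1 := pos_of_mem_coneL hL hz
    have h2 : Real.exp (-s ^ 2 * (z 0 * z 0 + z 1 * z 1)) < 1 := by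
      rw [Real.exp_lt_one_iff, neg_mul, neg_lt_zero]
      have := mul_self_nonneg (z 0)
      positivity
    nlinarith
  · simp only [hv, coneHarmonic_eq_zero hL hz, hβ_def, zero_mul]
  · have h1 : K * (1 - Real.exp (-s ^ 2)) = 1 := inv_mul_cancel₀ (by linarith)
    simp only [hv, hone]
    simp [p01]
    linarith
  · rw [integrableOn_congr_fun hsq hmeas]
    exact (integrableOn_coneL_comp_smul (integrableOn_dampedLaplacian hβ hq hL) hs).const_mul _
  · refine lt_of_le_of_lt ?_ hsδ
    rw [setIntegral_congr_fun hmeas hsq, integral_const_mul,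
      integral_coneL_comp_smul (fun z => |dampedLaplacian β z| ^ q) hs,
      Real.mul_rpow (by positivity) (by positivity), Real.mul_rpow (by positivity) hI,
      ← Real.rpow_mul (by positivity), mul_one_div_cancel hq.ne', Real.rpow_one, ← mul_assoc]
    have h1 : ((s ^ 2)⁻¹ : ℝ) ^ (1 / q) = s ^ (-(2 / q)) := by
      rw [← Real.rpow_two, ← Real.rpow_neg hs.le, ← Real.rpow_mul hs.le]
      ring_nf
    have h2 : s ^ (2 - β) * s ^ (-(2 / q)) = s ^ (-(β + 2 / q - 2)) := by
      rw [← Real.rpow_add hs]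
      ring_nf
    rw [h1, mul_assoc (4 * K), h2]
    gcongr
    linarith
  · have hlim : Tendsto (fun t : ℝ => M * (K + -K * Real.exp (-s ^ 2 * (t * t))))
        (nhdsWithin 0 (Ioi 0)) (nhds 0) := by
      have : Continuous fun t : ℝ => M * (K + -K * Real.exp (-s ^ 2 * (t * t))) := by fun_prop
      simpa using (this.tendsto 0).mono_left nhdsWithin_le_nhds
    obtain ⟨t, ht, ht0, ht2⟩ := ((hlim.eventually_lt_const one_pos).and
      (Ioo_mem_nhdsGT (by norm_num : (0 : ℝ) < 1 / 2))).exists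
    have hz : t • p01 ∈ coneL L := (smul_mem_coneL_iff ht0).2 hp
    refine ⟨t • p01, ⟨hz, ?_⟩, ?_⟩
    · rw [mem_ball_zero_iff, norm_smul, Real.norm_of_nonneg ht0.le]
      simpa [p01] using ht2
    · have h0 : (t • p01 : E2) 0 = 0 := by simp [p01]
      have h1 : (t • p01 : E2) 1 = t := by simp [p01]
      simp only [hv, h0, h1, mul_zero, zero_add]
      have := mul_lt_mul_of_pos_left ht (coneHarmonic_pos hL hz)
      rw [← hβ_def] at this
      linarith
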